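/- The image of the Casimir element Ω = qABC + q^2A^2 + q^{-2}B^2 + q^2C^2 − qAα − q^{-1}Bβ − qCγ of the universal Askey–Wilson algebra △_q under the embedding ♭ into U_q(sl_2)^{⊗3} equals (q+q^{-1})^2 − Λ^2⊗1⊗1 − 1⊗Λ^2⊗1 − 1⊗1⊗Λ^2 − (Λ⊗Λ⊗Λ)·Δ_2(Λ) − Δ_2(Λ)^2. -/

import Mathlib

open scoped TensorProduct

/-- Generators of the universal Askey–Wilson algebra. -/
inductive AWGen : Type | A | B | C

/-- The element `A + (qBC − q⁻¹CB)/(q² − q⁻²)` of the free algebra. -/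
noncomputable def awNA (F : Type) [Field F] (q : F) : FreeAlgebra F AWGen :=
  FreeAlgebra.ι F AWGen.A +
    (q ^ 2 - q⁻¹ ^ 2)⁻¹ •
      (q • (FreeAlgebra.ι F AWGen.B * FreeAlgebra.ι F AWGen.C) -
        q⁻¹ • (FreeAlgebra.ι F AWGen.C * FreeAlgebra.ι F AWGen.B))

/-- The element `B + (qCA − q⁻¹AC)/(q² − q⁻²)` of the free algebra. -/
noncomputable def awNB (F : Type) [Field F] (q : F) : FreeAlgebra F AWGen :=
  FreeAlgebra.ι F AWGen.B +
    (q ^ 2 - q⁻¹ ^ 2)⁻¹ •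
      (q • (FreeAlgebra.ι F AWGen.C * FreeAlgebra.ι F AWGen.A) -
        q⁻¹ • (FreeAlgebra.ι F AWGen.A * FreeAlgebra.ι F AWGen.C))

/-- The element `C + (qAB − q⁻¹BA)/(q² − q⁻²)` of the free algebra. -/
noncomputable def awNC (F : Type) [Field F] (q : F) : FreeAlgebra F AWGen :=
  FreeAlgebra.ι F AWGen.C +
    (q ^ 2 - q⁻¹ ^ 2)⁻¹ •
      (q • (FreeAlgebra.ι F AWGen.A * FreeAlgebra.ι F AWGen.B) -
        q⁻¹ • (FreeAlgebra.ι F AWGen.B * FreeAlgebra.ι F AWGen.A))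

/-- Defining relations of the universal Askey–Wilson algebra: each of the three
normalized elements commutes with the generators. -/
inductive AWRel (F : Type) [Field F] (q : F) :
    FreeAlgebra F AWGen → FreeAlgebra F AWGen → Prop
  | Acen (g : AWGen) :
      AWRel F q (awNA F q * FreeAlgebra.ι F g) (FreeAlgebra.ι F g * awNA F q)
  | Bcen (g : AWGen) :
      AWRel F q (awNB F q * FreeAlgebra.ι F g) (FreeAlgebra.ι F g * awNB F q)
  | Ccen (g : AWGen) :
      AWRel F q (awNC F q * FreeAlgebra.ι F g) (FreeAlgebra.ι F g * awNC F q)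

/-- The universal Askey–Wilson algebra `△_q`. -/
abbrev AWAlg (F : Type) [Field F] (q : F) := RingQuot (AWRel F q)

/-- The generator `A` of `△_q`. -/
noncomputable def AWA (F : Type) [Field F] (q : F) : AWAlg F q :=
  RingQuot.mkAlgHom F (AWRel F q) (FreeAlgebra.ι F AWGen.A)

/-- The generator `B` of `△_q`. -/
noncomputable def AWB (F : Type) [Field F] (q : F) : AWAlg F q :=
  RingQuot.mkAlgHom F (AWRel F q) (FreeAlgebra.ι F AWGen.B)

/-- The generator `C` of `△_q`. -/
noncomputable def AWC (F : Type) [Field F] (q : F) : AWAlg F q :=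
  RingQuot.mkAlgHom F (AWRel F q) (FreeAlgebra.ι F AWGen.C)

/-- The central element `α` of `△_q`. -/
noncomputable def AWalpha (F : Type) [Field F] (q : F) : AWAlg F q :=
  (q + q⁻¹) • (AWA F q + (q ^ 2 - q⁻¹ ^ 2)⁻¹ •
    (q • (AWB F q * AWC F q) - q⁻¹ • (AWC F q * AWB F q)))

/-- The central element `β` of `△_q`. -/
noncomputable def AWbeta (F : Type) [Field F] (q : F) : AWAlg F q :=
  (q + q⁻¹) • (AWB F q + (q ^ 2 - q⁻¹ ^ 2)⁻¹ •
    (q • (AWC F q * AWA F q) - q⁻¹ • (AWA F q * AWC F q)))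

/-- The central element `γ` of `△_q`. -/
noncomputable def AWgamma (F : Type) [Field F] (q : F) : AWAlg F q :=
  (q + q⁻¹) • (AWC F q + (q ^ 2 - q⁻¹ ^ 2)⁻¹ •
    (q • (AWA F q * AWB F q) - q⁻¹ • (AWB F q * AWA F q)))

/-- The Casimir element `Ω` of `△_q`. -/
noncomputable def AWOmega (F : Type) [Field F] (q : F) : AWAlg F q :=
  q • (AWA F q * AWB F q * AWC F q) + q ^ 2 • (AWA F q) ^ 2
    + q⁻¹ ^ 2 • (AWB F q) ^ 2 + q ^ 2 • (AWC F q) ^ 2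
    - q • (AWA F q * AWalpha F q) - q⁻¹ • (AWB F q * AWbeta F q)
    - q • (AWC F q * AWgamma F q)

section CasimirComputation

set_option linter.unusedSimpArgs false

variable {F : Type*} [Field F] {U : Type*} [Ring U] [Algebra F U]

/-- Relations of `U_q(sl₂)` in terms of the rescaled generators `e = (q - q⁻¹) E`,
`f = (q - q⁻¹) F`, the invertible element `K` with inverse `Ki`, and the Casimir element `L`. -/
structure UqRel (q : F) (L K Ki e f : U) : Prop where
  KKi : K * Ki = 1
  KiK : Ki * K = 1
  eK : e * K = (q⁻¹ * q⁻¹) • (K * e)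
  fK : f * K = (q * q) • (K * f)
  eKi : e * Ki = (q * q) • (Ki * e)
  fKi : f * Ki = (q⁻¹ * q⁻¹) • (Ki * f)
  ef : e * f = L + (-q⁻¹) • K + (-q) • Ki
  fe : f * e = L + (-q) • K + (-q⁻¹) • Ki
  KL : K * L = L * K
  KiL : Ki * L = L * Ki
  eL : e * L = L * e
  fL : f * L = L * f

theorem mul_mul_of_mul_eq {a b c : U} (h : a * b = c) (x : U) : a * (b * x) = c * x := by
  rw [← mul_assoc, h]

variable (F) in
/-- Pure tensors in the triple tensor product. -/
def tri (x y z : U) : U ⊗[F] (U ⊗[F] U) := x ⊗ₜ[F] (y ⊗ₜ[F] z)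

theorem tri_mul (x y z x' y' z' : U) :
    tri F x y z * tri F x' y' z' = tri F (x * x') (y * y') (z * z') := by
  simp [tri]

theorem tri_add_fst (x x' y z : U) : tri F (x + x') y z = tri F x y z + tri F x' y z := by
  simp [tri, TensorProduct.add_tmul]

theorem tri_add_snd (x y y' z : U) : tri F x (y + y') z = tri F x y z + tri F x y' z := by
  simp [tri, TensorProduct.add_tmul, TensorProduct.tmul_add]

theorem tri_add_trd (x y z z' : U) : tri F x y (z + z') = tri F x y z + tri F x y z' := by
  simp [tri, TensorProduct.tmul_add]

theorem tri_smul_fst (c : F) (x y z : U) : tri F (c • x) y z = c • tri F x y z := by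
  simp [tri, TensorProduct.smul_tmul']

theorem tri_smul_snd (c : F) (x y z : U) : tri F x (c • y) z = c • tri F x y z := by
  rw [tri, ← TensorProduct.smul_tmul', TensorProduct.tmul_smul, tri]

theorem tri_smul_trd (c : F) (x y z : U) : tri F x y (c • z) = c • tri F x y z := by
  simp [tri]

/-- The coupled Casimir element `Δ(Λ) ⊗ 1` in normal form. -/
def casimirLeft (q : F) (L K Ki e f : U) : U ⊗[F] (U ⊗[F] U) :=
    tri F L Ki 1 +
    tri F K L 1 +
    (-q + -q⁻¹) • tri F K Ki 1 +
    (q * q) • tri F (K * f) (Ki * e) 1 +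
    tri F e f 1

/-- The coupled Casimir element `1 ⊗ Δ(Λ)` in normal form. -/
def casimirRight (q : F) (L K Ki e f : U) : U ⊗[F] (U ⊗[F] U) :=
    tri F 1 L Ki +
    tri F 1 K L +
    (-q + -q⁻¹) • tri F 1 K Ki +
    (q * q) • tri F 1 (K * f) (Ki * e) +
    tri F 1 e f

/-- The total Casimir element `Δ₂(Λ)` in normal form. -/
def casimirTotal (q : F) (L K Ki e f : U) : U ⊗[F] (U ⊗[F] U) :=
    tri F L Ki Ki +
    tri F K L Ki +
    tri F K K L +
    (-q + -q⁻¹) • tri F K K Ki +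
    (q * q) • tri F K (K * f) (Ki * e) +
    tri F K e f +
    (-q + -q⁻¹) • tri F K Ki Ki +
    (q * q) • tri F (K * f) 1 (Ki * e) +
    (q * q) • tri F (K * f) (Ki * e) Ki +
    tri F e 1 f +
    tri F e f Ki

/-- The image of the generator `C` in normal form. -/
def casimirOuter (q : F) (L K Ki e f : U) : U ⊗[F] (U ⊗[F] U) :=
    tri F L 1 Ki +
    (-q) • tri F L f (Ki * e) +
    tri F K 1 L +
    (-q + -q⁻¹) • tri F K 1 Ki +
    (q * q + 1) • tri F K f (Ki * e) +
    (q * q) • tri F (K * f) Ki (Ki * e) +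
    tri F e K f +
    (-q) • tri F e (K * f) L +
    (q * q + 1) • tri F e (K * f) Ki +
    (-(q * q * q)) • tri F e (K * f * f) (Ki * e)

/-- The companion of `casimirOuter` obtained by exchanging `q` and `q⁻¹` in its definition. -/
def casimirOuterDual (q : F) (L K Ki e f : U) : U ⊗[F] (U ⊗[F] U) :=
    tri F L 1 Ki +
    (-q) • tri F L (Ki * e) f +
    tri F K 1 L +
    (-q + -q⁻¹) • tri F K 1 Ki +
    (q * q + 1) • tri F K (Ki * e) f +
    (q * q) • tri F (K * f) K (Ki * e) +
    (-q) • tri F (K * f) e L +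
    (q * q + 1) • tri F (K * f) e Ki +
    (-(q * q * q)) • tri F (K * f) (Ki * e * e) f +
    tri F e Ki f

namespace UqRel

variable {q : F} {L K Ki e f : U} (h : UqRel q L K Ki e f)
include h

theorem left_mul_right (hq : q ≠ 0) :
    casimirLeft q L K Ki e f * casimirRight q L K Ki e f =
      tri F L 1 L + tri F 1 L 1 * casimirTotal q L K Ki e f +
        (-q) • casimirOuter q L K Ki e f + (-q⁻¹) • casimirOuterDual q L K Ki e f := by
  simp only [casimirLeft, casimirRight, casimirTotal, casimirOuter, casimirOuterDual,
    mul_add, add_mul, smul_add, smul_mul_assoc, mul_smul_comm, smul_smul, tri_mul,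
    tri_add_fst, tri_add_snd, tri_add_trd, tri_smul_fst, tri_smul_snd, tri_smul_trd,
    mul_assoc, mul_one, one_mul,
    h.KKi, h.KiK, h.eK, h.fK, h.eKi, h.fKi, h.ef, h.fe, h.KL, h.KiL, h.eL, h.fL,
    mul_mul_of_mul_eq h.KKi, mul_mul_of_mul_eq h.KiK, mul_mul_of_mul_eq h.eK,
    mul_mul_of_mul_eq h.fK, mul_mul_of_mul_eq h.eKi, mul_mul_of_mul_eq h.fKi,
    mul_mul_of_mul_eq h.ef, mul_mul_of_mul_eq h.fe, mul_mul_of_mul_eq h.KL,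
    mul_mul_of_mul_eq h.KiL, mul_mul_of_mul_eq h.eL, mul_mul_of_mul_eq h.fL]
  match_scalars <;> field_simp

theorem right_mul_left (hq : q ≠ 0) :
    casimirRight q L K Ki e f * casimirLeft q L K Ki e f =
      tri F L 1 L + tri F 1 L 1 * casimirTotal q L K Ki e f +
        (-q⁻¹) • casimirOuter q L K Ki e f + (-q) • casimirOuterDual q L K Ki e f := by
  simp only [casimirLeft, casimirRight, casimirTotal, casimirOuter, casimirOuterDual,
    mul_add, add_mul, smul_add, smul_mul_assoc, mul_smul_comm, smul_smul, tri_mul,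
    tri_add_fst, tri_add_snd, tri_add_trd, tri_smul_fst, tri_smul_snd, tri_smul_trd,
    mul_assoc, mul_one, one_mul,
    h.KKi, h.KiK, h.eK, h.fK, h.eKi, h.fKi, h.ef, h.fe, h.KL, h.KiL, h.eL, h.fL,
    mul_mul_of_mul_eq h.KKi, mul_mul_of_mul_eq h.KiK, mul_mul_of_mul_eq h.eK,
    mul_mul_of_mul_eq h.fK, mul_mul_of_mul_eq h.eKi, mul_mul_of_mul_eq h.fKi,
    mul_mul_of_mul_eq h.ef, mul_mul_of_mul_eq h.fe, mul_mul_of_mul_eq h.KL,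
    mul_mul_of_mul_eq h.KiL, mul_mul_of_mul_eq h.eL, mul_mul_of_mul_eq h.fL]
  match_scalars <;> field_simp <;> ring

theorem qcomm_right_outer (hq : q ≠ 0) :
    q • (casimirRight q L K Ki e f * casimirOuter q L K Ki e f) +
      (-q⁻¹) • (casimirOuter q L K Ki e f * casimirRight q L K Ki e f) =
      (q - q⁻¹) • (tri F L L 1 + tri F 1 1 L * casimirTotal q L K Ki e f) +
      (-(q ^ 2 - q⁻¹ ^ 2)) • casimirLeft q L K Ki e f := by
  simp only [casimirLeft, casimirRight, casimirTotal, casimirOuter, casimirOuterDual,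
    mul_add, add_mul, smul_add, smul_mul_assoc, mul_smul_comm, smul_smul, tri_mul,
    tri_add_fst, tri_add_snd, tri_add_trd, tri_smul_fst, tri_smul_snd, tri_smul_trd,
    mul_assoc, mul_one, one_mul,
    h.KKi, h.KiK, h.eK, h.fK, h.eKi, h.fKi, h.ef, h.fe, h.KL, h.KiL, h.eL, h.fL,
    mul_mul_of_mul_eq h.KKi, mul_mul_of_mul_eq h.KiK, mul_mul_of_mul_eq h.eK,
    mul_mul_of_mul_eq h.fK, mul_mul_of_mul_eq h.eKi, mul_mul_of_mul_eq h.fKi,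
    mul_mul_of_mul_eq h.ef, mul_mul_of_mul_eq h.fe, mul_mul_of_mul_eq h.KL,
    mul_mul_of_mul_eq h.KiL, mul_mul_of_mul_eq h.eL, mul_mul_of_mul_eq h.fL]
  match_scalars <;> field_simp <;> ring

theorem qcomm_outer_left (hq : q ≠ 0) :
    q • (casimirOuter q L K Ki e f * casimirLeft q L K Ki e f) +
      (-q⁻¹) • (casimirLeft q L K Ki e f * casimirOuter q L K Ki e f) =
      (q - q⁻¹) • (tri F 1 L L + tri F L 1 1 * casimirTotal q L K Ki e f) +
      (-(q ^ 2 - q⁻¹ ^ 2)) • casimirRight q L K Ki e f := by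
  simp only [casimirLeft, casimirRight, casimirTotal, casimirOuter, casimirOuterDual,
    mul_add, add_mul, smul_add, smul_mul_assoc, mul_smul_comm, smul_smul, tri_mul,
    tri_add_fst, tri_add_snd, tri_add_trd, tri_smul_fst, tri_smul_snd, tri_smul_trd,
    mul_assoc, mul_one, one_mul,
    h.KKi, h.KiK, h.eK, h.fK, h.eKi, h.fKi, h.ef, h.fe, h.KL, h.KiL, h.eL, h.fL,
    mul_mul_of_mul_eq h.KKi, mul_mul_of_mul_eq h.KiK, mul_mul_of_mul_eq h.eK,
    mul_mul_of_mul_eq h.fK, mul_mul_of_mul_eq h.eKi, mul_mul_of_mul_eq h.fKi,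
    mul_mul_of_mul_eq h.ef, mul_mul_of_mul_eq h.fe, mul_mul_of_mul_eq h.KL,
    mul_mul_of_mul_eq h.KiL, mul_mul_of_mul_eq h.eL, mul_mul_of_mul_eq h.fL]
  match_scalars <;> field_simp <;> ring

set_option maxHeartbeats 4000000 in
theorem outerDual_mul_outer (hq : q ≠ 0) :
    casimirOuterDual q L K Ki e f * casimirOuter q L K Ki e f =
      (q ^ 2) • (casimirLeft q L K Ki e f * casimirLeft q L K Ki e f) +
      (q⁻¹ ^ 2) • (casimirRight q L K Ki e f * casimirRight q L K Ki e f) +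
      (-q) • (casimirLeft q L K Ki e f *
        (tri F L L 1 + tri F 1 1 L * casimirTotal q L K Ki e f)) +
      (-q⁻¹) • (casimirRight q L K Ki e f *
        (tri F 1 L L + tri F L 1 1 * casimirTotal q L K Ki e f)) +
      (-(q + q⁻¹) ^ 2) • tri F 1 1 1 +
      tri F (L * L) 1 1 + tri F 1 (L * L) 1 + tri F 1 1 (L * L) +
      tri F L L L * casimirTotal q L K Ki e f +
      casimirTotal q L K Ki e f * casimirTotal q L K Ki e f := by
  simp only [casimirLeft, casimirRight, casimirTotal, casimirOuter, casimirOuterDual,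
    mul_add, add_mul, smul_add, smul_mul_assoc, mul_smul_comm, smul_smul, tri_mul,
    tri_add_fst, tri_add_snd, tri_add_trd, tri_smul_fst, tri_smul_snd, tri_smul_trd,
    mul_assoc, mul_one, one_mul,
    h.KKi, h.KiK, h.eK, h.fK, h.eKi, h.fKi, h.ef, h.fe, h.KL, h.KiL, h.eL, h.fL,
    mul_mul_of_mul_eq h.KKi, mul_mul_of_mul_eq h.KiK, mul_mul_of_mul_eq h.eK,
    mul_mul_of_mul_eq h.fK, mul_mul_of_mul_eq h.eKi, mul_mul_of_mul_eq h.fKi,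
    mul_mul_of_mul_eq h.ef, mul_mul_of_mul_eq h.fe, mul_mul_of_mul_eq h.KL,
    mul_mul_of_mul_eq h.KiL, mul_mul_of_mul_eq h.eL, mul_mul_of_mul_eq h.fL]
  match_scalars <;> field_simp <;> ring

end UqRel

theorem UqRel.of_generators {q : F} (hq : q ≠ 0) (hs : q - q⁻¹ ≠ 0) {E K Ki Fg L : U}
    (hKKi : K * Ki = 1) (hKiK : Ki * K = 1)
    (hKE : K * E = q ^ 2 • (E * K)) (hKF : K * Fg = (q ^ 2)⁻¹ • (Fg * K))
    (hEF : E * Fg - Fg * E = (q - q⁻¹)⁻¹ • (K - Ki))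
    (hL : L = (q - q⁻¹) ^ 2 • (Fg * E) + q • K + q⁻¹ • Ki) :
    UqRel q L K Ki ((q - q⁻¹) • E) ((q - q⁻¹) • Fg) := by
  set s := q - q⁻¹ with hs_def
  have hEK : E * K = (q⁻¹ * q⁻¹) • (K * E) := by
    rw [hKE, smul_smul]; field_simp; rw [one_smul]
  have hFK : Fg * K = (q * q) • (K * Fg) := by
    rw [hKF, smul_smul]; field_simp; rw [one_smul]
  have hEKi : E * Ki = (q * q) • (Ki * E) := by
    calc E * Ki = Ki * (K * E) * Ki := by rw [← mul_assoc, hKiK, one_mul]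
      _ = (q * q) • (Ki * E * (K * Ki)) := by
        rw [hKE, mul_smul_comm, smul_mul_assoc, pow_two]; simp only [mul_assoc]
      _ = (q * q) • (Ki * E) := by rw [hKKi, mul_one]
  have hFKi : Fg * Ki = (q⁻¹ * q⁻¹) • (Ki * Fg) := by
    calc Fg * Ki = Ki * (K * Fg) * Ki := by rw [← mul_assoc, hKiK, one_mul]
      _ = (q⁻¹ * q⁻¹) • (Ki * Fg * (K * Ki)) := by
        rw [hKF, mul_smul_comm, smul_mul_assoc, pow_two, mul_inv]; simp only [mul_assoc]
      _ = (q⁻¹ * q⁻¹) • (Ki * Fg) := by rw [hKKi, mul_one]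
  have eK : (s • E) * K = (q⁻¹ * q⁻¹) • (K * (s • E)) := by
    rw [smul_mul_assoc, hEK, mul_smul_comm, smul_comm]
  have fK : (s • Fg) * K = (q * q) • (K * (s • Fg)) := by
    rw [smul_mul_assoc, hFK, mul_smul_comm, smul_comm]
  have eKi : (s • E) * Ki = (q * q) • (Ki * (s • E)) := by
    rw [smul_mul_assoc, hEKi, mul_smul_comm, smul_comm]
  have fKi : (s • Fg) * Ki = (q⁻¹ * q⁻¹) • (Ki * (s • Fg)) := by
    rw [smul_mul_assoc, hFKi, mul_smul_comm, smul_comm]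
  have fe : (s • Fg) * (s • E) = L + (-q) • K + (-q⁻¹) • Ki := by
    rw [hL, smul_mul_smul_comm]; module
  have ef : (s • E) * (s • Fg) = L + (-q⁻¹) • K + (-q) • Ki := by
    have h1 : (s • E) * (s • Fg) = (s • Fg) * (s • E) + s • (K - Ki) := by
      rw [smul_mul_smul_comm, smul_mul_smul_comm, eq_add_of_sub_eq hEF, smul_add, smul_smul,
        mul_assoc, mul_inv_cancel₀ hs, mul_one, add_comm]
    rw [h1, fe, hs_def]; module
  have hLfe : L = (s • Fg) * (s • E) + q • K + q⁻¹ • Ki := by rw [fe]; module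
  have hLef : L = (s • E) * (s • Fg) + q⁻¹ • K + q • Ki := by rw [ef]; module
  generalize s • E = e at *
  generalize s • Fg = f at *
  have Ke : K * e = (q * q) • (e * K) := by
    rw [eK, smul_smul]; field_simp; rw [one_smul]
  have Kie : Ki * e = (q⁻¹ * q⁻¹) • (e * Ki) := by
    rw [eKi, smul_smul]; field_simp; rw [one_smul]
  have Kf : K * f = (q⁻¹ * q⁻¹) • (f * K) := by
    rw [fK, smul_smul]; field_simp; rw [one_smul]
  have Kif : Ki * f = (q * q) • (f * Ki) := by
    rw [fKi, smul_smul]; field_simp; rw [one_smul]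
  have Kfe : K * (f * e) = f * e * K := by
    rw [← mul_assoc, Kf, smul_mul_assoc, mul_assoc, Ke, mul_smul_comm, smul_smul, mul_assoc]
    field_simp; rw [one_smul, mul_assoc]
  have Kife : Ki * (f * e) = f * e * Ki := by
    rw [← mul_assoc, Kif, smul_mul_assoc, mul_assoc, Kie, mul_smul_comm, smul_smul, mul_assoc]
    field_simp; rw [one_smul, mul_assoc]
  refine ⟨hKKi, hKiK, eK, fK, eKi, fKi, ef, fe, ?_, ?_, ?_, ?_⟩
  · rw [hLfe]
    simp only [mul_add, add_mul, Kfe, mul_smul_comm, smul_mul_assoc, hKKi, hKiK]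
  · rw [hLfe]
    simp only [mul_add, add_mul, Kife, mul_smul_comm, smul_mul_assoc, hKKi, hKiK]
  · have h1 : e * L = (e * f) * e + q • (e * K) + q⁻¹ • (e * Ki) := by
      conv_lhs => rw [hLfe]
      simp only [mul_add, mul_smul_comm, mul_assoc]
    rw [h1, ef, eK, eKi]
    simp only [add_mul, smul_mul_assoc]
    match_scalars <;> field_simp <;> ring
  · have h1 : f * L = (f * e) * f + q⁻¹ • (f * K) + q • (f * Ki) := by
      conv_lhs => rw [hLef]
      simp only [mul_add, mul_smul_comm, mul_assoc]
    rw [h1, fe, fK, fKi]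
    simp only [add_mul, smul_mul_assoc]
    match_scalars <;> field_simp <;> ring

theorem UqRel.comul_casimir {q : F} (hq : q ≠ 0) {E K Ki Fg L : U}
    (h : UqRel q L K Ki ((q - q⁻¹) • E) ((q - q⁻¹) • Fg))
    (Δ : U →ₐ[F] U ⊗[F] U)
    (hΔE : Δ E = E ⊗ₜ[F] 1 + K ⊗ₜ[F] E)
    (hΔF : Δ Fg = Fg ⊗ₜ[F] Ki + 1 ⊗ₜ[F] Fg)
    (hΔK : Δ K = K ⊗ₜ[F] K)
    (hΔKi : Δ Ki = Ki ⊗ₜ[F] Ki) :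
    Δ L = L ⊗ₜ[F] Ki + K ⊗ₜ[F] L + (-q + -q⁻¹) • K ⊗ₜ[F] Ki +
      (q * q) • (K * ((q - q⁻¹) • Fg)) ⊗ₜ[F] (Ki * ((q - q⁻¹) • E)) +
      ((q - q⁻¹) • E) ⊗ₜ[F] ((q - q⁻¹) • Fg) := by
  have hL' : L = ((q - q⁻¹) • Fg) * ((q - q⁻¹) • E) + q • K + q⁻¹ • Ki := by
    rw [h.fe]; module
  have hΔe : Δ ((q - q⁻¹) • E) = ((q - q⁻¹) • E) ⊗ₜ[F] 1 + K ⊗ₜ[F] ((q - q⁻¹) • E) := by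
    rw [map_smul, hΔE, smul_add, TensorProduct.smul_tmul', TensorProduct.tmul_smul]
  have hΔf : Δ ((q - q⁻¹) • Fg) =
      ((q - q⁻¹) • Fg) ⊗ₜ[F] Ki + 1 ⊗ₜ[F] ((q - q⁻¹) • Fg) := by
    rw [map_smul, hΔF, smul_add, TensorProduct.smul_tmul', TensorProduct.tmul_smul]
  generalize (q - q⁻¹) • E = e at *
  generalize (q - q⁻¹) • Fg = f at *
  conv_lhs => rw [hL']
  simp only [map_add, map_mul, map_smul, hΔe, hΔf, hΔK, hΔKi]
  simp only [add_mul, mul_add, Algebra.TensorProduct.tmul_mul_tmul, one_mul, mul_one, h.fe, h.fK,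
    TensorProduct.add_tmul, TensorProduct.tmul_add, ← TensorProduct.smul_tmul',
    TensorProduct.tmul_smul]
  match_scalars <;> field_simp <;> ring

section qCommutator

variable {T : Type*} [Ring T] [Algebra F T] {q : F}

theorem scaled_qcomm_eq (hs : q - q⁻¹ ≠ 0) (hp : q + q⁻¹ ≠ 0) {X Y Z c : T}
    (h : q • Y + (-q⁻¹) • Z = (q - q⁻¹) • c + (-(q ^ 2 - q⁻¹ ^ 2)) • X) :
    (q + q⁻¹) • (X + (q ^ 2 - q⁻¹ ^ 2)⁻¹ • (q • Y - q⁻¹ • Z)) = c := by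
  have hfac : q ^ 2 - q⁻¹ ^ 2 = (q + q⁻¹) * (q - q⁻¹) := by ring
  rw [sub_eq_add_neg (q • Y), ← neg_smul, h, hfac]
  generalize q + q⁻¹ = p at *
  generalize q - q⁻¹ = s at *
  match_scalars <;> field_simp <;> ring

theorem eq_of_scaled_qcomm_eq (hs : q - q⁻¹ ≠ 0) (hp : q + q⁻¹ ≠ 0) {X X' Y Z c : T}
    (h : q • Y + (-q⁻¹) • Z = (q - q⁻¹) • c + (-(q ^ 2 - q⁻¹ ^ 2)) • X')
    (hX : (q + q⁻¹) • (X + (q ^ 2 - q⁻¹ ^ 2)⁻¹ • (q • Y - q⁻¹ • Z)) = c) : X = X' := by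
  have h' := hX.trans (scaled_qcomm_eq hs hp h).symm
  exact add_right_cancel ((IsUnit.mk0 _ hp).smul_left_cancel.mp h')

theorem qcomm_of_mul_eq (hq : q ≠ 0) {A B C C' c : T}
    (hAB : A * B = c + (-q) • C + (-q⁻¹) • C') (hBA : B * A = c + (-q⁻¹) • C + (-q) • C') :
    q • (A * B) + (-q⁻¹) • (B * A) = (q - q⁻¹) • c + (-(q ^ 2 - q⁻¹ ^ 2)) • C := by
  rw [hAB, hBA]
  match_scalars <;> field_simp <;> ring

theorem casimir_eq_of_mul_eq (hq : q ≠ 0) {A B C C' α β γ x y z w d : T}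
    (hAB : A * B = γ + (-q) • C + (-q⁻¹) • C') (hγ : C * γ = γ * C)
    (hCC : C' * C = q ^ 2 • (A * A) + q⁻¹ ^ 2 • (B * B) + (-q) • (A * α) + (-q⁻¹) • (B * β) +
      (-(q + q⁻¹) ^ 2) • 1 + x + y + z + w + d * d) :
    q • (A * B * C) + q ^ 2 • A ^ 2 + q⁻¹ ^ 2 • B ^ 2 + q ^ 2 • C ^ 2
      - q • (A * α) - q⁻¹ • (B * β) - q • (C * γ) =
    algebraMap F T ((q + q⁻¹) ^ 2) - x - y - z - w - d ^ 2 := by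
  have h : q • (A * B * C) = q • (γ * C) + (-q ^ 2) • (C * C) - C' * C := by
    rw [hAB]
    simp only [add_mul, smul_mul_assoc]
    match_scalars
    all_goals field_simp
  rw [h, hγ, hCC, Algebra.algebraMap_eq_smul_one]
  simp only [pow_two A, pow_two B, pow_two C, pow_two d]
  module

end qCommutator

theorem AWgamma_mul_AWC (F' : Type) [Field F'] (q : F') : AWgamma F' q * AWC F' q = AWC F' q * AWgamma F' q := by
  have h := RingQuot.mkAlgHom_rel F' (AWRel.Ccen (F := F') (q := q) AWGen.C)
  simp only [map_mul] at h
  have hN : AWgamma F' q = (q + q⁻¹) • RingQuot.mkAlgHom F' (AWRel F' q) (awNC F' q) := by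
    simp [AWgamma, awNC, AWA, AWB, AWC]
  rw [hN, smul_mul_assoc, mul_smul_comm, AWC, h]

end CasimirComputation

/-- The image under the embedding `♭ : △_q → U_q(sl₂)^{⊗3}` of the
Casimir element `Ω = qABC + q²A² + q⁻²B² + q²C² − qAα − q⁻¹Bβ − qCγ` equals
`(q+q⁻¹)² − Λ²⊗1⊗1 − 1⊗Λ²⊗1 − 1⊗1⊗Λ² − (Λ⊗Λ⊗Λ)·Δ₂(Λ) − Δ₂(Λ)²`. -/
theorem aw_casimir_image (F : Type) [Field F] (q : F) (hq0 : q ≠ 0)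
    (hq4 : q ^ 4 ≠ 1)
    (U : Type) [Ring U] [Algebra F U] (E K Kinv Fg : U)
    (hKKinv : K * Kinv = 1) (hKinvK : Kinv * K = 1)
    (hKE : K * E = q ^ 2 • (E * K))
    (hKF : K * Fg = (q ^ 2)⁻¹ • (Fg * K))
    (hEF : E * Fg - Fg * E = (q - q⁻¹)⁻¹ • (K - Kinv))
    (Lam : U) (hLam : Lam = (q - q⁻¹) ^ 2 • (Fg * E) + q • K + q⁻¹ • Kinv)
    (Δ : U →ₐ[F] U ⊗[F] U)
    (hΔE : Δ E = E ⊗ₜ[F] 1 + K ⊗ₜ[F] E)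
    (hΔF : Δ Fg = Fg ⊗ₜ[F] Kinv + 1 ⊗ₜ[F] Fg)
    (hΔK : Δ K = K ⊗ₜ[F] K)
    (hΔKinv : Δ Kinv = Kinv ⊗ₜ[F] Kinv)
    (Δ₂ : U →ₐ[F] U ⊗[F] (U ⊗[F] U))
    (hΔ₂ : Δ₂ = (Algebra.TensorProduct.map (AlgHom.id F U) Δ).comp Δ)
    (flat : AWAlg F q →ₐ[F] U ⊗[F] (U ⊗[F] U))
    (hA : flat (AWA F q) =
        (Algebra.TensorProduct.map (AlgHom.id F U)
          (Algebra.TensorProduct.includeLeft : U →ₐ[F] U ⊗[F] U)) (Δ Lam))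
    (hB : flat (AWB F q) =
        (Algebra.TensorProduct.includeRight : U ⊗[F] U →ₐ[F] U ⊗[F] (U ⊗[F] U)) (Δ Lam))
    (hγ : flat (AWgamma F q) =
        Lam ⊗ₜ[F] ((1 : U) ⊗ₜ[F] Lam) +
          ((1 : U) ⊗ₜ[F] (Lam ⊗ₜ[F] (1 : U))) * Δ₂ Lam) :
    flat (AWOmega F q) =
      algebraMap F (U ⊗[F] (U ⊗[F] U)) ((q + q⁻¹) ^ 2)
        - (Lam ^ 2) ⊗ₜ[F] ((1 : U) ⊗ₜ[F] (1 : U))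
        - (1 : U) ⊗ₜ[F] ((Lam ^ 2) ⊗ₜ[F] (1 : U))
        - (1 : U) ⊗ₜ[F] ((1 : U) ⊗ₜ[F] (Lam ^ 2))
        - (Lam ⊗ₜ[F] (Lam ⊗ₜ[F] Lam)) * Δ₂ Lam
        - (Δ₂ Lam) ^ 2 := by
  have hq2 : q ^ 2 - q⁻¹ ^ 2 ≠ 0 := by
    intro h
    apply hq4
    field_simp at h
    linear_combination h
  have hfac : q ^ 2 - q⁻¹ ^ 2 = (q + q⁻¹) * (q - q⁻¹) := by ring
  have hs : q - q⁻¹ ≠ 0 := right_ne_zero_of_mul (hfac ▸ hq2)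
  have hp : q + q⁻¹ ≠ 0 := left_ne_zero_of_mul (hfac ▸ hq2)
  have h := UqRel.of_generators hq0 hs hKKinv hKinvK hKE hKF hEF hLam
  have hΔL := h.comul_casimir hq0 Δ hΔE hΔF hΔK hΔKinv
  have hΔe : Δ ((q - q⁻¹) • E) = ((q - q⁻¹) • E) ⊗ₜ[F] 1 + K ⊗ₜ[F] ((q - q⁻¹) • E) := by
    rw [map_smul, hΔE, smul_add, TensorProduct.smul_tmul', TensorProduct.tmul_smul]
  have hΔf : Δ ((q - q⁻¹) • Fg) =
      ((q - q⁻¹) • Fg) ⊗ₜ[F] Kinv + 1 ⊗ₜ[F] ((q - q⁻¹) • Fg) := by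
    rw [map_smul, hΔF, smul_add, TensorProduct.smul_tmul', TensorProduct.tmul_smul]
  generalize (q - q⁻¹) • E = e at *
  generalize (q - q⁻¹) • Fg = f at *
  replace hA : flat (AWA F q) = casimirLeft q Lam K Kinv e f := by
    simp [hA, hΔL, casimirLeft, tri]
  replace hB : flat (AWB F q) = casimirRight q Lam K Kinv e f := by
    simp [hB, hΔL, casimirRight, tri, TensorProduct.tmul_add]
  have hd : Δ₂ Lam = casimirTotal q Lam K Kinv e f := by
    simp only [hΔ₂, hΔL, AlgHom.comp_apply, map_add, map_smul, map_mul, hΔe, hΔf, hΔKinv,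
      Algebra.TensorProduct.map_tmul, AlgHom.id_apply, casimirTotal, tri, mul_add,
      Algebra.TensorProduct.tmul_mul_tmul, mul_one, hKinvK, TensorProduct.tmul_add,
      TensorProduct.tmul_smul, smul_add]
    module
  rw [hd] at hγ ⊢
  have hγ' : flat (AWgamma F q) = tri F Lam 1 Lam + tri F 1 Lam 1 * casimirTotal q Lam K Kinv e f :=
    hγ
  have hAB := h.left_mul_right hq0
  have hBA := h.right_mul_left hq0
  have hBC := h.qcomm_right_outer hq0
  have hCA := h.qcomm_outer_left hq0
  have hCC := h.outerDual_mul_outer hq0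
  rw [← hγ', ← hA, ← hB] at hAB hBA
  have hC : flat (AWC F q) = casimirOuter q Lam K Kinv e f := by
    have h1 : flat (AWgamma F q) = (q + q⁻¹) • (flat (AWC F q) + (q ^ 2 - q⁻¹ ^ 2)⁻¹ •
        (q • (flat (AWA F q) * flat (AWB F q)) - q⁻¹ • (flat (AWB F q) * flat (AWA F q)))) := by
      simp only [AWgamma, map_smul, map_add, map_sub, map_mul]
    exact eq_of_scaled_qcomm_eq hs hp (qcomm_of_mul_eq hq0 hAB hBA) h1.symm
  rw [← hC] at hAB hBA hCC
  rw [← hC, ← hA, ← hB] at hBC hCA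
  rw [← hA, ← hB] at hCC
  have hα : flat (AWalpha F q) =
      tri F Lam Lam 1 + tri F 1 1 Lam * casimirTotal q Lam K Kinv e f := by
    simp only [AWalpha, map_smul, map_add, map_sub, map_mul]
    exact scaled_qcomm_eq hs hp hBC
  have hβ : flat (AWbeta F q) =
      tri F 1 Lam Lam + tri F Lam 1 1 * casimirTotal q Lam K Kinv e f := by
    simp only [AWbeta, map_smul, map_add, map_sub, map_mul]
    exact scaled_qcomm_eq hs hp hCA
  rw [← hα, ← hβ] at hCC
  have hγC : flat (AWC F q) * flat (AWgamma F q) = flat (AWgamma F q) * flat (AWC F q) := by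
    rw [← map_mul, ← map_mul, AWgamma_mul_AWC]
  have h1 : tri F (1 : U) 1 1 = 1 := rfl
  rw [h1] at hCC
  simp only [tri] at hCC
  have key := casimir_eq_of_mul_eq hq0 hAB hγC hCC
  simp only [AWOmega, map_sub, map_add, map_smul, map_mul, map_pow, pow_two Lam]
  rw [map_pow, map_add] at key
  exact key
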